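/- Let M be a smooth minimal hypersurface of R^{n+1} (H ≡ 0) and p ∈ [1,n). Then for every φ ∈ C^1_c(M): ((n−p)/p)^p ∫_M |φ|^p/|x|^p dV ≤ ∫_M |∇_T φ|^p dV. That is, the Euclidean Hardy inequality with its sharp constant holds on every minimal hypersurface. -/

import Mathlib

open MeasureTheory
open scoped RealInnerProductSpace

noncomputable section

/-- Ambient Euclidean space `ℝ^{n+1}`. -/
abbrev Eu (n : ℕ) := EuclideanSpace ℝ (Fin (n + 1))

/-- A smooth `n`-dimensional hypersurface of `ℝ^{n+1}`, described by its carrier set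
together with a smooth unit normal field; locally it is a regular level set of a
smooth function. -/
structure Hypersurface (n : ℕ) where
  carrier : Set (Eu n)
  nu : Eu n → Eu n
  smooth_nu : ContDiff ℝ (⊤ : ℕ∞) nu
  unit_nu : ∀ x ∈ carrier, ‖nu x‖ = 1
  locally_level_set : ∀ x ∈ carrier, ∃ U : Set (Eu n), IsOpen U ∧ x ∈ U ∧
    ∃ f : Eu n → ℝ, ContDiff ℝ (⊤ : ℕ∞) f ∧
      carrier ∩ U = {y ∈ U | f y = 0} ∧
      (∀ y ∈ U, gradient f y ≠ 0) ∧
      (∀ y ∈ carrier ∩ U, nu y = ‖gradient f y‖⁻¹ • gradient f y)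

variable {n : ℕ}

/-- The `i`-th tangential derivative `δ_i φ = ∂_i φ − ν^i ∑_j (∂_j φ) ν^j`. -/
def tderiv (ν : Eu n → Eu n) (i : Fin (n + 1)) (φ : Eu n → ℝ) (x : Eu n) : ℝ :=
  fderiv ℝ φ x (EuclideanSpace.single i 1)
    - ν x i * ∑ j, fderiv ℝ φ x (EuclideanSpace.single j 1) * ν x j

/-- The tangential gradient `∇_T φ = ∇φ − (∇φ·ν)ν`. -/
def tgrad (ν : Eu n → Eu n) (φ : Eu n → ℝ) (x : Eu n) : Eu n :=
  gradient φ x - ⟪gradient φ x, ν x⟫ • ν x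

/-- The tangential divergence `div_T Z = ∑ i δ_i Z^i`. -/
def tdiv (ν : Eu n → Eu n) (Z : Eu n → Eu n) (x : Eu n) : ℝ :=
  ∑ i, tderiv ν i (fun y => Z y i) x

/-- The mean curvature `H = div_T ν` (sum of the principal curvatures). -/
def meanCurv (M : Hypersurface n) (x : Eu n) : ℝ := tdiv M.nu M.nu x

/-- The Laplace–Beltrami operator `Δφ = div_T (∇_T φ)`. -/
def lapBel (ν : Eu n → Eu n) (φ : Eu n → ℝ) (x : Eu n) : ℝ := tdiv ν (tgrad ν φ) x

/-- The surface measure on `M`: the `n`-dimensional Hausdorff measure restricted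
to the carrier of `M`. -/
def surfMeasure (M : Hypersurface n) : Measure (Eu n) :=
  (μH[(n : ℝ)]).restrict M.carrier

/-- `C^1` functions with compact support in a set `S`: ambient `C^1` functions
vanishing on `S` outside a compact subset `K ⊆ S`. -/
def C1cOn (S : Set (Eu n)) (φ : Eu n → ℝ) : Prop :=
  ContDiff ℝ 1 φ ∧ ∃ K : Set (Eu n), IsCompact K ∧ K ⊆ S ∧ ∀ x ∈ S, x ∉ K → φ x = 0


abbrev Wp (u : Eu n) : Submodule ℝ (Eu n) := (ℝ ∙ u)ᗮ

abbrev Pp (u : Eu n) : Eu n →L[ℝ] Wp u := (Wp u).orthogonalProjectionOnto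

lemma Pp_coe (u x : Eu n) (hu : ‖u‖ = 1) : (Pp u x : Eu n) = x - ⟪u, x⟫ • u := by
  have := Submodule.starProjection_unit_singleton ℝ hu x
  rw [← this]
  have h2 := Submodule.starProjection_add_starProjection_orthogonal (K := ℝ ∙ u) x
  rw [eq_sub_iff_add_eq, add_comm]
  exact h2

lemma exists_R (u v : Eu n) (hu : ‖u‖ = 1) (hv : ‖v‖ = 1) (ht : 0 < ⟪v, u⟫) :
    ∃ B : Wp u →ₗ[ℝ] Wp u, ∃ R : Eu n →L[ℝ] Wp u, LinearMap.det B = ⟪v, u⟫ ∧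
      (∀ x, B (R x) = Pp u x) ∧ ∀ x, ⟪v, x⟫ = 0 → ‖R x‖ = ‖x‖ := by
  set t := ⟪v, u⟫ with htdef
  have huu : ⟪u, u⟫ = 1 := by rw [real_inner_self_eq_norm_sq, hu]; norm_num
  have hvv : ⟪v, v⟫ = 1 := by rw [real_inner_self_eq_norm_sq, hv]; norm_num
  have huv : ⟪u, v⟫ = t := real_inner_comm _ _
  have h1t : (1 + t) ≠ 0 := by positivity
  set d := u + v with hd
  set f : Module.Dual ℝ (Wp u) := (-(1 / (1 + t))) • (innerSL ℝ (Pp u d)).toLinearMap with hf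
  set B := LinearMap.transvection f (Pp u d) with hB
  have hPd : ⟪Pp u d, Pp u d⟫ = 1 - t ^ 2 := by
    rw [Submodule.coe_inner, Pp_coe u d hu, hd]
    simp only [inner_sub_left, inner_sub_right, inner_add_left, inner_add_right,
      inner_smul_left, inner_smul_right, huu, hvv, huv, ← htdef]
    simp
    ring
  have hdet : LinearMap.det B = t := by
    rw [hB, LinearMap.transvection.det, hf]
    simp only [LinearMap.smul_apply, smul_eq_mul, ContinuousLinearMap.coe_coe, innerSL_apply_apply]
    rw [hPd]; field_simp; ring
  have hBne : LinearMap.det B ≠ 0 := by rw [hdet]; exact ht.ne'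
  set Be := LinearMap.equivOfDetNeZero B hBne with hBe
  have hBe' : ∀ w, Be w = B w := fun w => rfl
  refine ⟨B, (Be.symm.toLinearMap.toContinuousLinearMap).comp (Pp u), hdet, ?_, ?_⟩
  · intro x
    exact Be.apply_symm_apply _
  · intro x hx
    have hw : x - (⟪u, x⟫ / (1 + t)) • d ∈ Wp u := by
      rw [Submodule.mem_orthogonal_singleton_iff_inner_right]
      simp only [hd, inner_sub_right, inner_add_right, inner_smul_right, huu, huv]
      field_simp; ring
    have key : Be ⟨_, hw⟩ = Pp u x := by
      rw [hBe', hB, LinearMap.transvection.apply, hf]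
      apply Subtype.ext
      simp only [LinearMap.smul_apply, smul_eq_mul, ContinuousLinearMap.coe_coe,
        innerSL_apply_apply, Submodule.coe_add, Submodule.coe_smul, Submodule.coe_inner,
        Pp_coe _ _ hu]
      simp only [hd, inner_sub_left, inner_sub_right, inner_add_left, inner_add_right,
        inner_smul_left, inner_smul_right, huu, hvv, huv, hx, ← htdef]
      simp
      have e : (1 + t)⁻¹ * (⟪u, x⟫ - (1 + t) * ⟪u, x⟫ - ⟪u, x⟫ / (1 + t) * (t + 1 - (1 + t) * t))
          = - (⟪u, x⟫ / (1 + t)) := by field_simp; ring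
      rw [e]
      have e2 : ⟪u, x⟫ = (⟪u, x⟫ / (1 + t)) * (1 + t) := by field_simp
      generalize ⟪u, x⟫ / (1 + t) = s at *
      rw [e2]
      module
    have : Be.symm (Pp u x) = ⟨_, hw⟩ := by rw [← key, Be.symm_apply_apply]
    change ‖Be.symm (Pp u x)‖ = _
    rw [this]
    change ‖x - (⟪u, x⟫ / (1 + t)) • d‖ = _
    rw [← sq_eq_sq₀ (norm_nonneg _) (norm_nonneg _), ← real_inner_self_eq_norm_sq,
      ← real_inner_self_eq_norm_sq]
    have hx2 : ⟪x, v⟫ = 0 := by rw [real_inner_comm]; exact hx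
    have hx3 : ⟪x, u⟫ = ⟪u, x⟫ := real_inner_comm _ _
    simp only [hd, inner_sub_left, inner_sub_right, inner_add_left, inner_add_right,
        inner_smul_left, inner_smul_right, huu, hvv, huv, hx, hx2, hx3, ← htdef]
    simp
    field_simp
    ring

lemma finrank_Wp (u : Eu n) (hu : ‖u‖ = 1) : Module.finrank ℝ (Wp u) = n := by
  have : Fact (Module.finrank ℝ (Eu n) = n + 1) := ⟨by simp⟩
  exact Submodule.finrank_orthogonal_span_singleton (by
    intro h; rw [h] at hu; simp at hu)

lemma haar_Wp (u : Eu n) (hu : ‖u‖ = 1) :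
    (μH[(n : ℝ)] : Measure (Wp u)).IsAddHaarMeasure := by
  have h := isAddHaarMeasure_hausdorffMeasure (E := Wp u)
  rwa [finrank_Wp u hu] at h

lemma flat_nhds (M : Hypersurface n) (x₁ : Eu n) (hx : x₁ ∈ M.carrier) (ε : ℝ) (hε : 0 < ε) :
    ∃ N : Set (Eu n), IsOpen N ∧ x₁ ∈ N ∧ ∀ x ∈ M.carrier ∩ N, ∀ y ∈ M.carrier ∩ N,
      |⟪M.nu x₁, x - y⟫| ≤ ε * ‖x - y‖ := by
  obtain ⟨U, hU, hxU, f, hf, hlev, hg, hnu⟩ := M.locally_level_set x₁ hx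
  have hstr : HasStrictFDerivAt f (fderiv ℝ f x₁) x₁ :=
    hf.contDiffAt.hasStrictFDerivAt (by simp)
  have hgpos : 0 < ‖gradient f x₁‖ := norm_pos_iff.2 (hg x₁ hxU)
  have h := (hstr.isLittleO.def (c := ε * ‖gradient f x₁‖) (by positivity))
  rw [nhds_prod_eq] at h
  obtain ⟨N, hN, hN'⟩ := Filter.eventually_prod_self_iff'.1 h
  obtain ⟨N2, hN2, hN2o, hN2x⟩ := mem_nhds_iff.1 (Filter.inter_mem hN (hU.mem_nhds hxU))
  refine ⟨N2, hN2o, hN2x, ?_⟩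
  intro x hx' y hy
  have fx : f x = 0 := by
    have : x ∈ M.carrier ∩ U := ⟨hx'.1, (hN2 hx'.2).2⟩
    rw [hlev] at this; exact this.2
  have fy : f y = 0 := by
    have : y ∈ M.carrier ∩ U := ⟨hy.1, (hN2 hy.2).2⟩
    rw [hlev] at this; exact this.2
  have h3 := hN' x (hN2 hx'.2).1 y (hN2 hy.2).1
  simp only [fx, fy, sub_zero, zero_sub, norm_neg, Real.norm_eq_abs] at h3
  rw [hnu x₁ ⟨hx, hxU⟩, inner_smul_left, inner_gradient_left]
  simp only [map_inv₀, conj_trivial, abs_mul, abs_inv, abs_norm]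
  rw [inv_mul_le_iff₀ hgpos]
  linarith

lemma local_area (M : Hypersurface n) (x₁ : Eu n) (hx : x₁ ∈ M.carrier) (u : Eu n) (hu : ‖u‖ = 1)
    (ht : 0 < ⟪M.nu x₁, u⟫) (K : NNReal) (hK : 1 < K) :
    ∃ N : Set (Eu n), IsOpen N ∧ x₁ ∈ N ∧ ∀ S ⊆ M.carrier ∩ N,
      μH[(n : ℝ)] (Pp u '' S) ≤ (K : ENNReal) ^ n * (ENNReal.ofReal ⟪M.nu x₁, u⟫ * μH[(n : ℝ)] S) ∧
      ENNReal.ofReal ⟪M.nu x₁, u⟫ * μH[(n : ℝ)] S ≤ (K : ENNReal) ^ n * μH[(n : ℝ)] (Pp u '' S) := by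
  obtain ⟨B, R, hdet, hBR, hR⟩ := exists_R u (M.nu x₁) hu (M.unit_nu x₁ hx) ht
  have hK1 : (1 : ℝ) < K := by exact_mod_cast hK
  set δ : ℝ := 1 - 1 / (K : ℝ) with hδ
  have hδ0 : 0 < δ := by rw [hδ, sub_pos, div_lt_one (by positivity)]; exact hK1
  set C : ℝ := 1 + ‖R‖ with hC
  have hC0 : 0 < C := by positivity
  obtain ⟨N, hNo, hxN, hN⟩ := flat_nhds M x₁ hx (δ / C) (by positivity)
  refine ⟨N, hNo, hxN, ?_⟩
  have hvn := M.unit_nu x₁ hx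
  have hvv : ⟪M.nu x₁, M.nu x₁⟫ = 1 := by rw [real_inner_self_eq_norm_sq, hvn]; norm_num
  have bil : ∀ x ∈ M.carrier ∩ N, ∀ y ∈ M.carrier ∩ N, |‖R (x - y)‖ - ‖x - y‖| ≤ δ * ‖x - y‖ := by
    intro x hx y hy
    have h1 := hN x hx y hy
    set z := x - y
    set s := ⟪M.nu x₁, z⟫ with hs
    have h2 : ‖R (z - s • M.nu x₁)‖ = ‖z - s • M.nu x₁‖ := by
      apply hR
      rw [inner_sub_right, inner_smul_right, hvv, ← hs]; ring
    have h3 : |‖z‖ - ‖z - s • M.nu x₁‖| ≤ |s| := by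
      refine (abs_norm_sub_norm_le _ _).trans ?_
      simp [norm_smul, hvn]
    have h4 : |‖R z‖ - ‖R (z - s • M.nu x₁)‖| ≤ ‖R‖ * |s| := by
      refine (abs_norm_sub_norm_le _ _).trans ?_
      rw [← map_sub]
      refine (R.le_opNorm _).trans ?_
      simp [norm_smul, hvn]
    rw [h2] at h4
    have h5 : C * |s| ≤ δ * ‖z‖ := by
      have := mul_le_mul_of_nonneg_left h1 hC0.le
      have e : C * (δ / C * ‖z‖) = δ * ‖z‖ := by field_simp
      linarith
    rw [abs_le] at *
    rw [hC] at h5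
    constructor <;> nlinarith [h3.1, h3.2, h4.1, h4.2]
  have up : ∀ x ∈ M.carrier ∩ N, ∀ y ∈ M.carrier ∩ N, ‖R x - R y‖ ≤ K * ‖x - y‖ := by
    intro x hx y hy
    have := (abs_le.1 (bil x hx y hy)).2
    rw [map_sub] at this
    have h2 : δ ≤ K - 1 := by
      rw [hδ, ← sub_nonneg]
      have : (K : ℝ) - 1 - (1 - 1 / K) = (K - 1) ^ 2 / K := by field_simp
      rw [this]; positivity
    nlinarith [norm_nonneg (x - y)]
  have lo : ∀ x ∈ M.carrier ∩ N, ∀ y ∈ M.carrier ∩ N, ‖x - y‖ ≤ K * ‖R x - R y‖ := by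
    intro x hx y hy
    have := (abs_le.1 (bil x hx y hy)).1
    rw [map_sub] at this
    have h2 : ‖x - y‖ * (1 / K) ≤ ‖R x - R y‖ := by rw [hδ] at this; linarith
    have : ‖x - y‖ = K * (‖x - y‖ * (1 / K)) := by field_simp
    rw [this]
    gcongr
  intro S hS
  have := haar_Wp u hu
  have himg : Pp u '' S = B '' (R '' S) := by
    rw [Set.image_image]; exact Set.image_congr (fun x _ => (hBR x).symm)
  have hP : μH[(n : ℝ)] (Pp u '' S) = ENNReal.ofReal ⟪M.nu x₁, u⟫ * μH[(n : ℝ)] (R '' S) := by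
    rw [himg, Measure.addHaar_image_linearMap, hdet, abs_of_pos ht]
  have hL : μH[(n : ℝ)] (R '' S) ≤ (K : ENNReal) ^ n * μH[(n : ℝ)] S := by
    have : LipschitzOnWith K R S := by
      apply LipschitzOnWith.of_dist_le_mul
      intro x hx y hy
      rw [dist_eq_norm, dist_eq_norm]
      exact up x (hS hx) y (hS hy)
    have := this.hausdorffMeasure_image_le (d := n) (by positivity)
    rwa [ENNReal.rpow_natCast] at this
  have hinj : Set.InjOn R S := by
    intro x hx y hy hxy
    have := lo x (hS hx) y (hS hy)
    rw [hxy, sub_self, norm_zero, mul_zero] at this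
    exact sub_eq_zero.1 (norm_le_zero_iff.1 this)
  have hU : μH[(n : ℝ)] S ≤ (K : ENNReal) ^ n * μH[(n : ℝ)] (R '' S) := by
    have h1 : LipschitzOnWith K (Function.invFunOn R S) (R '' S) := by
      apply LipschitzOnWith.of_dist_le_mul
      rintro _ ⟨x, hx, rfl⟩ _ ⟨y, hy, rfl⟩
      rw [hinj.leftInvOn_invFunOn hx, hinj.leftInvOn_invFunOn hy, dist_eq_norm, dist_eq_norm]
      exact lo x (hS hx) y (hS hy)
    have := h1.hausdorffMeasure_image_le (d := n) (by positivity)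
    rwa [ENNReal.rpow_natCast, hinj.leftInvOn_invFunOn.image_image] at this
  rw [hP]
  constructor
  · rw [mul_left_comm]
    gcongr
  · rw [mul_left_comm]
    gcongr

lemma local_area2 (M : Hypersurface n) (x₁ : Eu n) (hx : x₁ ∈ M.carrier) (u : Eu n) (hu : ‖u‖ = 1)
    (ht : 0 < ⟪M.nu x₁, u⟫) (K : NNReal) (hK : 1 < K) :
    ∃ N : Set (Eu n), IsOpen N ∧ x₁ ∈ N ∧ ∀ S ⊆ M.carrier ∩ N, MeasurableSet S →
      μH[(n : ℝ)] (Pp u '' S) ≤ (K : ENNReal) ^ (n + 1) *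
        ∫⁻ x in S, ENNReal.ofReal ⟪M.nu x, u⟫ ∂μH[(n : ℝ)] ∧
      ∫⁻ x in S, ENNReal.ofReal ⟪M.nu x, u⟫ ∂μH[(n : ℝ)]
        ≤ (K : ENNReal) ^ (n + 1) * μH[(n : ℝ)] (Pp u '' S) := by
  obtain ⟨N, hNo, hxN, hN⟩ := local_area M x₁ hx u hu ht K hK
  have hc : Continuous fun y => ⟪M.nu y, u⟫ := M.smooth_nu.continuous.inner continuous_const
  have hK1 : (1 : ℝ) < K := by exact_mod_cast hK
  refine ⟨N ∩ {y | ⟪M.nu x₁, u⟫ < K * ⟪M.nu y, u⟫ ∧ ⟪M.nu y, u⟫ < K * ⟪M.nu x₁, u⟫}, ?_, ?_, ?_⟩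
  · exact hNo.inter ((isOpen_lt continuous_const (hc.const_mul _)).inter
      (isOpen_lt hc continuous_const))
  · exact ⟨hxN, by constructor <;> nlinarith⟩
  · intro S hS hSm
    obtain ⟨h1, h2⟩ := hN S (fun x hx => ⟨(hS hx).1, (hS hx).2.1⟩)
    set t := ENNReal.ofReal ⟪M.nu x₁, u⟫
    have a1 : t * μH[(n : ℝ)] S ≤ K * ∫⁻ x in S, ENNReal.ofReal ⟪M.nu x, u⟫ ∂μH[(n : ℝ)] := by
      rw [← lintegral_const_mul' _ _ ENNReal.coe_ne_top, ← setLIntegral_const]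
      apply setLIntegral_mono' hSm
      intro x hx
      rw [← ENNReal.ofReal_coe_nnreal, ← ENNReal.ofReal_mul (by positivity)]
      exact ENNReal.ofReal_le_ofReal (hS hx).2.2.1.le
    have a2 : ∫⁻ x in S, ENNReal.ofReal ⟪M.nu x, u⟫ ∂μH[(n : ℝ)] ≤ K * (t * μH[(n : ℝ)] S) := by
      rw [← mul_assoc, ← setLIntegral_const]
      apply setLIntegral_mono' hSm
      intro x hx
      rw [← ENNReal.ofReal_coe_nnreal, ← ENNReal.ofReal_mul (by positivity)]
      exact ENNReal.ofReal_le_ofReal (hS hx).2.2.2.le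
    constructor
    · rw [pow_succ, mul_assoc]
      exact h1.trans (by gcongr)
    · rw [pow_succ', mul_assoc]
      exact a2.trans (by gcongr)

lemma area_aux (M : Hypersurface n) (u : Eu n) (hu : ‖u‖ = 1)
    (S : Set (Eu n)) (hS : S ⊆ M.carrier) (hSm : MeasurableSet S)
    (hpos : ∀ x ∈ S, 0 < ⟪M.nu x, u⟫) (hinj : Set.InjOn (Pp u) S) (K : NNReal) (hK : 1 < K) :
      μH[(n : ℝ)] (Pp u '' S) ≤ (K : ENNReal) ^ (n + 1) *
        ∫⁻ x in S, ENNReal.ofReal ⟪M.nu x, u⟫ ∂μH[(n : ℝ)] ∧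
      ∫⁻ x in S, ENNReal.ofReal ⟪M.nu x, u⟫ ∂μH[(n : ℝ)]
        ≤ (K : ENNReal) ^ (n + 1) * μH[(n : ℝ)] (Pp u '' S) := by
  rcases S.eq_empty_or_nonempty with rfl | hne
  · simp
  have H : ∀ x : Eu n, ∃ N : Set (Eu n), IsOpen N ∧ (x ∈ S → x ∈ N) ∧
      ∀ T ⊆ M.carrier ∩ N, MeasurableSet T →
      μH[(n : ℝ)] (Pp u '' T) ≤ (K : ENNReal) ^ (n + 1) *
        ∫⁻ x in T, ENNReal.ofReal ⟪M.nu x, u⟫ ∂μH[(n : ℝ)] ∧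
      ∫⁻ x in T, ENNReal.ofReal ⟪M.nu x, u⟫ ∂μH[(n : ℝ)]
        ≤ (K : ENNReal) ^ (n + 1) * μH[(n : ℝ)] (Pp u '' T) := by
    intro x
    by_cases hx : x ∈ S
    · obtain ⟨N, h1, h2, h3⟩ := local_area2 M x (hS hx) u hu (hpos x hx) K hK
      exact ⟨N, h1, fun _ => h2, h3⟩
    · refine ⟨∅, isOpen_empty, fun h => (hx h).elim, ?_⟩
      intro T hT _
      have : T = ∅ := by simpa using hT
      subst this; simp
  choose N hNo hxN hN using H
  obtain ⟨t, htS, htc, hcov⟩ := TopologicalSpace.countable_cover_nhdsWithin (f := N) (s := S)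
    (fun x hx => mem_nhdsWithin_of_mem_nhds ((hNo x).mem_nhds (hxN x hx)))
  have htne : t.Nonempty := by
    obtain ⟨x, hx⟩ := hne
    have := hcov hx
    simp only [Set.mem_iUnion] at this
    obtain ⟨i, hi, _⟩ := this
    exact ⟨i, hi⟩
  obtain ⟨g, hg⟩ := htc.exists_eq_range htne
  set T : ℕ → Set (Eu n) := fun k => S ∩ disjointed (fun k => N (g k)) k with hT
  have hTm : ∀ k, MeasurableSet (T k) := fun k =>
    hSm.inter (MeasurableSet.disjointed (fun k => (hNo (g k)).measurableSet) k)
  have hTd : Pairwise (Function.onFun Disjoint T) := fun i j hij =>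
    (disjoint_disjointed (fun k => N (g k)) hij).mono Set.inter_subset_right Set.inter_subset_right
  have hTU : S = ⋃ k, T k := by
    rw [hT, ← Set.inter_iUnion, iUnion_disjointed, eq_comm, Set.inter_eq_left]
    intro x hx
    have := hcov hx
    rw [hg] at this
    simpa using this
  have hTk : ∀ k, T k ⊆ M.carrier ∩ N (g k) := fun k x hx =>
    ⟨hS hx.1, disjointed_subset (fun k => N (g k)) k hx.2⟩
  have hTS : ∀ k, T k ⊆ S := fun k => Set.inter_subset_left
  have e1 : ∫⁻ x in S, ENNReal.ofReal ⟪M.nu x, u⟫ ∂μH[(n : ℝ)] =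
      ∑' k, ∫⁻ x in T k, ENNReal.ofReal ⟪M.nu x, u⟫ ∂μH[(n : ℝ)] := by
    conv_lhs => rw [hTU]
    exact lintegral_iUnion hTm hTd _
  have e2 : μH[(n : ℝ)] (Pp u '' S) = ∑' k, μH[(n : ℝ)] (Pp u '' T k) := by
    conv_lhs => rw [hTU]
    rw [Set.image_iUnion]
    apply measure_iUnion
    · intro i j hij
      apply Set.disjoint_image_image
      intro x hx y hy hxy
      have := hinj (hTS i hx) (hTS j hy) hxy
      subst this
      exact Set.disjoint_left.1 (hTd hij) hx hy
    · intro k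
      exact (hTm k).image_of_continuousOn_injOn (Pp u).continuous.continuousOn
        (hinj.mono (hTS k))
  rw [e1, e2, ← ENNReal.tsum_mul_left, ← ENNReal.tsum_mul_left]
  exact ⟨ENNReal.tsum_le_tsum fun k => (hN _ _ (hTk k) (hTm k)).1,
    ENNReal.tsum_le_tsum fun k => (hN _ _ (hTk k) (hTm k)).2⟩

lemma area (M : Hypersurface n) (u : Eu n) (hu : ‖u‖ = 1)
    (S : Set (Eu n)) (hS : S ⊆ M.carrier) (hSm : MeasurableSet S)
    (hpos : ∀ x ∈ S, 0 < ⟪M.nu x, u⟫) (hinj : Set.InjOn (Pp u) S) :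
      ∫⁻ x in S, ENNReal.ofReal ⟪M.nu x, u⟫ ∂μH[(n : ℝ)] = μH[(n : ℝ)] (Pp u '' S) := by
  have key : ∀ a b : ENNReal, (∀ K : NNReal, 1 < K → a ≤ (K : ENNReal) ^ (n + 1) * b) → a ≤ b := by
    intro a b h
    have hlim : Filter.Tendsto (fun K : NNReal => (K : ENNReal) ^ (n + 1) * b)
        (nhdsWithin 1 (Set.Ioi 1)) (nhds (1 * b)) := by
      apply ENNReal.Tendsto.mul_const _ (Or.inl one_ne_zero)
      have : Filter.Tendsto (fun K : NNReal => ((K ^ (n + 1) : NNReal) : ENNReal))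
        (nhdsWithin 1 (Set.Ioi 1)) (nhds ((1 ^ (n + 1) : NNReal) : ENNReal)) := by
        apply Filter.Tendsto.mono_left _ nhdsWithin_le_nhds
        rw [ENNReal.tendsto_coe]
        exact (continuous_pow (n + 1)).tendsto 1
      simpa using this
    rw [one_mul] at hlim
    exact ge_of_tendsto hlim (Filter.eventually_of_mem self_mem_nhdsWithin h)
  apply le_antisymm
  · exact key _ _ fun K hK => (area_aux M u hu S hS hSm hpos hinj K hK).2
  · exact key _ _ fun K hK => (area_aux M u hu S hS hSm hpos hinj K hK).1

lemma meas_carrier (M : Hypersurface n) : MeasurableSet M.carrier := by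
  have h : IsLocallyClosed M.carrier := by
    refine ((isLocallyClosed_tfae M.carrier).out 0 3).2 ?_
    intro x hx
    obtain ⟨U, hU, hxU, f, hf, hlev, -, -⟩ := M.locally_level_set x hx
    refine ⟨U, hxU, hU, ?_⟩
    rintro y ⟨hyU, hyc⟩
    have h1 : y ∈ closure (U ∩ M.carrier) := hU.inter_closure ⟨hyU, hyc⟩
    have h2 : U ∩ M.carrier ⊆ {y | f y = 0} := by
      rw [Set.inter_comm, hlev]; exact fun z hz => hz.2
    have h3 : f y = 0 :=
      closure_minimal h2 (isClosed_eq hf.continuous continuous_const) h1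
    have : y ∈ M.carrier ∩ U := by rw [hlev]; exact ⟨hyU, h3⟩
    exact this.1
  obtain ⟨A, B, hA, hB, hAB⟩ := h
  rw [hAB]
  exact hA.measurableSet.inter hB.measurableSet

lemma surf_compact (M : Hypersurface n) (K : Set (Eu n)) (hK : IsCompact K) (hKM : K ⊆ M.carrier) :
    surfMeasure M K < ⊤ := by
  refine lt_of_le_of_lt (Measure.restrict_apply_le _ _) ?_
  apply hK.measure_lt_top_of_nhdsWithin
  intro x hx
  have hv := M.unit_nu x (hKM hx)
  have ht : ⟪M.nu x, M.nu x⟫ = 1 := by rw [real_inner_self_eq_norm_sq, hv]; norm_num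
  obtain ⟨N, hNo, hxN, hN⟩ := local_area M x (hKM hx) (M.nu x) hv (by rw [ht]; norm_num) 2
    (by norm_num)
  refine ⟨N ∩ K ∩ K, ?_, ?_⟩
  · rw [Set.inter_assoc, Set.inter_self]
    exact Filter.inter_mem (mem_nhdsWithin_of_mem_nhds (hNo.mem_nhds hxN)) self_mem_nhdsWithin
  · have h1 := (hN (N ∩ K ∩ K) (fun y hy => ⟨hKM hy.2, hy.1.1⟩)).2
    rw [ht, ENNReal.ofReal_one, one_mul] at h1
    refine h1.trans_lt (ENNReal.mul_lt_top (by simp [ENNReal.pow_lt_top_iff]) ?_)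
    have := haar_Wp (M.nu x) hv
    refine lt_of_le_of_lt (measure_mono (Set.image_mono Set.inter_subset_right)) ?_
    exact (hK.image (Pp (M.nu x)).continuous).measure_lt_top

lemma integrable_surf (M : Hypersurface n) (K : Set (Eu n)) (hK : IsCompact K)
    (hKM : K ⊆ M.carrier) (q : Eu n → ℝ) (hq : Continuous q)
    (h0 : ∀ x ∈ M.carrier, x ∉ K → q x = 0) : Integrable q (surfMeasure M) := by
  have h1 : IntegrableOn q K (surfMeasure M) := by
    obtain ⟨C, hC⟩ := hK.exists_bound_of_continuousOn hq.continuousOn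
    refine IntegrableOn.of_bound (surf_compact M K hK hKM) hq.aestronglyMeasurable C ?_
    exact (ae_restrict_iff' hK.measurableSet).2 (Filter.Eventually.of_forall hC)
  have h2 := h1.integrable_indicator hK.measurableSet
  refine h2.congr ?_
  unfold surfMeasure
  refine (ae_restrict_iff' (meas_carrier M)).2 (Filter.Eventually.of_forall ?_)
  intro x hx
  by_cases hxK : x ∈ K
  · simp [hxK]
  · simp [hxK, h0 x hx hxK]

lemma ae_surf (M : Hypersurface n) {p : Eu n → Prop} (h : ∀ x ∈ M.carrier, p x) :
    ∀ᵐ x ∂surfMeasure M, p x :=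
  (ae_restrict_iff' (meas_carrier M)).2 (Filter.Eventually.of_forall h)

lemma tang (M : Hypersurface n) (h : Eu n → ℝ) (hh : ContDiff ℝ 1 h) (x : Eu n)
    (hx : x ∈ M.carrier) (V : Set (Eu n)) (hV : V ∈ nhds x) (h0 : ∀ y ∈ M.carrier ∩ V, h y = 0) :
    ∃ c : ℝ, ∀ v, fderiv ℝ h x v = c * ⟪M.nu x, v⟫ := by
  obtain ⟨U, hU, hxU, f, hf, hlev, hg, hnu⟩ := M.locally_level_set x hx
  have hfx : f x = 0 := by
    have : x ∈ M.carrier ∩ U := ⟨hx, hxU⟩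
    rw [hlev] at this; exact this.2
  have hloc : IsLocalExtrOn h {y | f y = f x} x := by
    left
    have : V ∩ U ∈ nhdsWithin x {y | f y = f x} :=
      mem_nhdsWithin_of_mem_nhds (Filter.inter_mem hV (hU.mem_nhds hxU))
    filter_upwards [this, self_mem_nhdsWithin] with y hy hy2
    have hyM : y ∈ M.carrier ∩ U := by rw [hlev]; exact ⟨hy.2, hy2.trans hfx⟩
    rw [h0 y ⟨hyM.1, hy.1⟩, h0 x ⟨hx, mem_of_mem_nhds hV⟩]
  obtain ⟨a, b, hab, heq⟩ := hloc.exists_multipliers_of_hasStrictFDerivAt_1d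
    (hf.contDiffAt.hasStrictFDerivAt (by simp)) (hh.contDiffAt.hasStrictFDerivAt (by simp))
  have hgx := hg x hxU
  have hfd : ∀ v, fderiv ℝ f x v = ‖gradient f x‖ * ⟪M.nu x, v⟫ := by
    intro v
    rw [hnu x ⟨hx, hxU⟩, inner_smul_left, inner_gradient_left]
    have : ‖gradient f x‖ ≠ 0 := norm_ne_zero_iff.2 hgx
    simp; field_simp
  have hb : b ≠ 0 := by
    intro hb
    rw [hb, zero_smul, add_zero] at heq
    rcases smul_eq_zero.1 heq with h1 | h1
    · exact hab (by simp [h1, hb])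
    · apply hgx; rw [gradient, h1, map_zero]
  refine ⟨-(a / b) * ‖gradient f x‖, fun v => ?_⟩
  have := congrArg (fun L => L v) heq
  simp only [add_apply, smul_apply, smul_eq_mul, hfd,
    zero_apply] at this
  field_simp
  linarith

/-- The antisymmetric tangential operator. -/
def Bop (M : Hypersurface n) (h : Eu n → ℝ) (a b x : Eu n) : ℝ :=
  ⟪M.nu x, a⟫ * fderiv ℝ h x b - ⟪M.nu x, b⟫ * fderiv ℝ h x a

lemma Bop_zero (M : Hypersurface n) (h : Eu n → ℝ) (hh : ContDiff ℝ 1 h) (x : Eu n)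
    (hx : x ∈ M.carrier) (V : Set (Eu n)) (hV : V ∈ nhds x) (h0 : ∀ y ∈ M.carrier ∩ V, h y = 0)
    (a b : Eu n) : Bop M h a b x = 0 := by
  obtain ⟨c, hc⟩ := tang M h hh x hx V hV h0
  rw [Bop, hc, hc]; ring

lemma Bop_cont (M : Hypersurface n) (h : Eu n → ℝ) (hh : ContDiff ℝ 1 h) (a b : Eu n) :
    Continuous (Bop M h a b) := by
  have h1 := hh.continuous_fderiv (by simp)
  have h2 := M.smooth_nu.continuous
  unfold Bop
  fun_prop

lemma Bop_integrable (M : Hypersurface n) (K : Set (Eu n)) (hK : IsCompact K)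
    (hKM : K ⊆ M.carrier) (h : Eu n → ℝ) (hh : ContDiff ℝ 1 h)
    (h0 : ∀ x ∈ M.carrier, x ∉ K → h x = 0) (a b : Eu n) :
    Integrable (Bop M h a b) (surfMeasure M) := by
  refine integrable_surf M K hK hKM _ (Bop_cont M h hh a b) ?_
  intro x hx hxK
  refine Bop_zero M h hh x hx Kᶜ (hK.isClosed.isOpen_compl.mem_nhds hxK) ?_ a b
  exact fun y hy => h0 y hy.1 hy.2

lemma Pp_self (u : Eu n) (hu : ‖u‖ = 1) : Pp u u = 0 := by
  apply Subtype.ext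
  rw [Pp_coe u u hu, real_inner_self_eq_norm_sq, hu]; simp

/-- The straightening isomorphism. -/
def strE (u : Eu n) (hu : ‖u‖ = 1) (L : Eu n →L[ℝ] ℝ) (hL : L u ≠ 0) :
    Eu n ≃L[ℝ] (Wp u × ℝ) :=
  ContinuousLinearEquiv.equivOfInverse ((Pp u).prod L)
    ((Wp u).subtypeL.comp (ContinuousLinearMap.fst ℝ _ _) +
      (((L u)⁻¹ • (ContinuousLinearMap.snd ℝ (Wp u) ℝ -
        (L.comp (Wp u).subtypeL).comp (ContinuousLinearMap.fst ℝ _ _))).smulRight u))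
    (by
      intro x
      simp [Pp_coe u x hu]
      field_simp
      simp)
    (by
      rintro ⟨w, s⟩
      have := Pp_self u hu
      simp [this]
      field_simp
      simp)

lemma integral_fderiv_zero {W : Type*} [NormedAddCommGroup W] [NormedSpace ℝ W]
    [FiniteDimensional ℝ W] [MeasurableSpace W] [BorelSpace W] (μ : Measure W)
    [μ.IsAddHaarMeasure] (k : W → ℝ) (hk : ContDiff ℝ 1 k) (hc : HasCompactSupport k) (v : W) :
    ∫ w, fderiv ℝ k w v ∂μ = 0 := by
  have hcont : Continuous fun w => fderiv ℝ k w v :=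
    (hk.continuous_fderiv (by simp)).clm_apply continuous_const
  have h1 : Integrable (fun w => fderiv ℝ k w v) μ := by
    apply hcont.integrable_of_hasCompactSupport
    exact (hc.fderiv (𝕜 := ℝ)).comp_left (g := fun L => L v) (by simp)
  have h2 : Integrable k μ := hk.continuous.integrable_of_hasCompactSupport hc
  have := integral_mul_fderiv_eq_neg_fderiv_mul_of_integrable (μ := μ) (f := k) (g := fun _ => (1 : ℝ))
    (v := v) (by simpa using h1) (by simp) (by simpa using h2)
    (fun x _ => (hk.differentiable (by simp)) x) (fun x _ => by fun_prop)
  simpa using this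

lemma area_integral (M : Hypersurface n) (u : Eu n) (hu : ‖u‖ = 1)
    (S : Set (Eu n)) (hS : S ⊆ M.carrier) (hSm : MeasurableSet S)
    (hpos : ∀ x ∈ S, 0 < ⟪M.nu x, u⟫) (hinj : Set.InjOn (Pp u) S) (q : Wp u → ℝ)
    (hq : Continuous q) :
    ∫ w in Pp u '' S, q w ∂μH[(n : ℝ)] = ∫ x in S, ⟪M.nu x, u⟫ * q (Pp u x) ∂μH[(n : ℝ)] := by
  have hc : Continuous fun y => ⟪M.nu y, u⟫ := M.smooth_nu.continuous.inner continuous_const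
  have hmeas : Measurable fun x => ENNReal.ofReal ⟪M.nu x, u⟫ := hc.measurable.ennreal_ofReal
  have hmap : Measure.map (Pp u) ((μH[(n : ℝ)].restrict S).withDensity
      (fun x => ENNReal.ofReal ⟪M.nu x, u⟫)) = μH[(n : ℝ)].restrict (Pp u '' S) := by
    ext A hA
    have hPm := (Pp u).continuous.measurable hA
    rw [Measure.map_apply (Pp u).continuous.measurable hA, withDensity_apply _ hPm,
      Measure.restrict_restrict hPm, Measure.restrict_apply hA,
      area M u hu _ (fun x hx => hS hx.2) (hPm.inter hSm) (fun x hx => hpos x hx.2)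
        (hinj.mono Set.inter_subset_right), Set.image_preimage_inter]
  rw [← hmap, integral_map (Pp u).continuous.measurable.aemeasurable
    hq.aestronglyMeasurable, integral_withDensity_eq_integral_toReal_smul hmeas (by simp)]
  apply setIntegral_congr_fun hSm
  intro x hx
  simp only [smul_eq_mul]
  rw [ENNReal.toReal_ofReal (hpos x hx).le]

lemma local_B (M : Hypersurface n) (x₀ : Eu n) (hx : x₀ ∈ M.carrier) (u : Eu n) (hu : ‖u‖ = 1)
    (ht : 0 < ⟪M.nu x₀, u⟫) : ∃ U : Set (Eu n), IsOpen U ∧ x₀ ∈ U ∧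
    ∀ h : Eu n → ℝ, ContDiff ℝ 1 h → HasCompactSupport h → tsupport h ⊆ U →
      ∀ v, ∫ x, Bop M h u v x ∂surfMeasure M = 0 := by
  obtain ⟨U₀, hU₀, hxU₀, f, hf, hlev, hg, hnu⟩ := M.locally_level_set x₀ hx
  have hfu : fderiv ℝ f x₀ u ≠ 0 := by
    rw [hnu x₀ ⟨hx, hxU₀⟩, inner_smul_left, inner_gradient_left] at ht
    intro h; rw [h] at ht; simp at ht
  have hΨ : ContDiff ℝ 1 (fun x => (Pp u x, f x)) :=
    (Pp u).contDiff.prodMk (hf.of_le (by simp))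
  have hΨd : ∀ y (hy : fderiv ℝ f y u ≠ 0), HasFDerivAt (fun x => (Pp u x, f x))
      ((strE u hu (fderiv ℝ f y) hy : Eu n ≃L[ℝ] (Wp u × ℝ)) : Eu n →L[ℝ] (Wp u × ℝ)) y := by
    intro y hy
    exact (Pp u).hasFDerivAt.prodMk (hf.differentiable (by simp) y).hasFDerivAt
  set e₀ := hΨ.contDiffAt.toOpenPartialHomeomorph _ (hΨd x₀ hfu) (by simp) with he₀
  have he₀c : ∀ x, e₀ x = (Pp u x, f x) := fun x => rfl
  have hc : Continuous fun y => ⟪M.nu y, u⟫ := M.smooth_nu.continuous.inner continuous_const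
  have hcf : Continuous fun y => fderiv ℝ f y u :=
    (hf.continuous_fderiv (by simp)).clm_apply continuous_const
  set U₁ : Set (Eu n) := U₀ ∩ ({y | 0 < ⟪M.nu y, u⟫} ∩ {y | fderiv ℝ f y u ≠ 0}) with hU₁
  have hU₁o : IsOpen U₁ := hU₀.inter ((isOpen_lt continuous_const hc).inter
    (isOpen_ne_fun hcf continuous_const))
  set e := e₀.restrOpen U₁ hU₁o with he
  have hec : ∀ x, e x = (Pp u x, f x) := fun x => rfl
  have hes : e.source = e₀.source ∩ U₁ := rfl
  refine ⟨e.source, e.open_source, ?_, ?_⟩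
  · rw [hes]
    exact ⟨hΨ.contDiffAt.mem_toOpenPartialHomeomorph_source _ _, hxU₀, ht, hfu⟩
  intro h hh hcs hsup v
  set C : Set (Wp u × ℝ) := e '' tsupport h with hC
  have hCc : IsCompact C := by
    apply IsCompact.image_of_continuousOn hcs
    exact e.continuousOn.mono hsup
  have hCt : C ⊆ e.target := by
    rintro _ ⟨x, hx, rfl⟩; exact e.map_source (hsup hx)
  classical
  set H : Wp u × ℝ → ℝ := fun y => if y ∈ e.target then h (e.symm y) else 0 with hH
  have hH0 : ∀ y, y ∉ C → H y = 0 := by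
    intro y hy
    simp only [hH]
    split_ifs with hyt
    · by_contra hne
      exact hy ⟨e.symm y, subset_tsupport _ hne, e.right_inv hyt⟩
    · rfl
  have hHc : ContDiff ℝ 1 H := by
    rw [contDiff_iff_contDiffAt]
    intro y
    by_cases hy : y ∈ C
    · have hyt := hCt hy
      have : H =ᶠ[nhds y] fun y => h (e.symm y) := by
        filter_upwards [e.open_target.mem_nhds hyt] with z hz
        simp [hH, hz]
      refine ContDiffAt.congr_of_eventuallyEq ?_ this
      apply hh.contDiffAt.comp
      have hys := e.map_target hyt
      rw [hes] at hys
      exact e.contDiffAt_symm hyt (hΨd _ hys.2.2.2) hΨ.contDiffAt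
    · have : H =ᶠ[nhds y] fun y => 0 := by
        filter_upwards [hCc.isClosed.isOpen_compl.mem_nhds hy] with z hz
        exact hH0 z hz
      exact contDiffAt_const.congr_of_eventuallyEq this
  set k : Wp u → ℝ := fun w => H (w, 0) with hk
  have hkc : ContDiff ℝ 1 k := hHc.comp (contDiff_id.prodMk contDiff_const)
  have hks : HasCompactSupport k := by
    apply HasCompactSupport.intro (hCc.image continuous_fst)
    intro w hw
    exact hH0 _ (fun h => hw ⟨_, h, rfl⟩)
  set S : Set (Eu n) := M.carrier ∩ e.source with hS
  have hSm : MeasurableSet S := (meas_carrier M).inter e.open_source.measurableSet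
  have hSf : ∀ x ∈ S, f x = 0 := by
    intro x hx
    have : x ∈ M.carrier ∩ U₀ := ⟨hx.1, hx.2.2.1⟩
    rw [hlev] at this; exact this.2
  have hinj : Set.InjOn (Pp u) S := by
    intro x hx y hy hxy
    apply e.injOn hx.2 hy.2
    rw [hec, hec, hxy, hSf x hx, hSf y hy]
  have hkP : ∀ x ∈ S, k (Pp u x) = h x := by
    intro x hx
    have h1 : e x = (Pp u x, 0) := by rw [hec, hSf x hx]
    have h2 : (Pp u x, (0 : ℝ)) ∈ e.target := by rw [← h1]; exact e.map_source hx.2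
    simp only [hk, hH, if_pos h2]
    rw [← h1, e.left_inv hx.2]
  have := haar_Wp u hu
  have hint := integral_fderiv_zero (μH[(n : ℝ)] : Measure (Wp u)) k hkc hks (Pp u v)
  have hout : ∀ w, w ∉ Pp u '' S → fderiv ℝ k w (Pp u v) = 0 := by
    intro w hw
    have hwC : (w, (0 : ℝ)) ∉ C := by
      rintro ⟨x, hx, hxw⟩
      rw [hec, Prod.mk.injEq] at hxw
      apply hw
      refine ⟨x, ⟨?_, hsup hx⟩, hxw.1⟩
      have : x ∈ M.carrier ∩ U₀ := by rw [hlev]; exact ⟨(hsup hx).2.1, hxw.2⟩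
      exact this.1
    have : k =ᶠ[nhds w] fun _ => 0 := by
      have hcw : ContinuousAt (fun w : Wp u => (w, (0 : ℝ))) w := by fun_prop
      filter_upwards [hcw (hCc.isClosed.isOpen_compl.mem_nhds hwC)] with z hz
      exact hH0 _ hz
    rw [this.fderiv_eq]; simp
  rw [← setIntegral_eq_integral_of_forall_compl_eq_zero (s := Pp u '' S) (fun w hw => hout w hw),
    area_integral M u hu S (fun x hx => hx.1) hSm (fun x hx => hx.2.2.2.1) hinj
      (fun w => fderiv ℝ k w (Pp u v))
      ((hkc.continuous_fderiv (by simp)).clm_apply continuous_const)] at hint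
  have hpt : ∀ x ∈ S, Bop M h u v x = ⟪M.nu x, u⟫ * fderiv ℝ k (Pp u x) (Pp u v) := by
    intro x hx
    have hkPc : ContDiff ℝ 1 (fun y => k (Pp u y)) := hkc.comp (Pp u).contDiff
    have h1 := Bop_zero M (fun y => h y - k (Pp u y)) (hh.sub hkPc) x hx.1 e.source
      (e.open_source.mem_nhds hx.2) (fun y hy => by rw [hkP y hy]; ring) u v
    have h2 : fderiv ℝ (fun y => h y - k (Pp u y)) x =
        fderiv ℝ h x - (fderiv ℝ k (Pp u x)).comp (Pp u) := by
      apply HasFDerivAt.fderiv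
      exact (hh.differentiable (by simp) x).hasFDerivAt.sub
        (((hkc.differentiable (by simp) _).hasFDerivAt).comp x (Pp u).hasFDerivAt)
    rw [Bop, h2] at h1
    simp only [sub_apply, ContinuousLinearMap.comp_apply, Pp_self u hu, map_zero] at h1
    rw [Bop]
    linarith
  rw [← setIntegral_congr_fun hSm hpt, hS, Set.inter_comm,
    ← Measure.restrict_restrict e.open_source.measurableSet] at hint
  rw [← hint]
  symm
  apply setIntegral_eq_integral_of_forall_compl_eq_zero
  intro x hx
  have : x ∉ tsupport h := fun h => hx (hsup h)
  have h3 : fderiv ℝ h x = 0 := by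
    by_contra hne
    exact this (support_fderiv_subset ℝ hne)
  simp [Bop, h3]

lemma Bop_smul_left (M : Hypersurface n) (h : Eu n → ℝ) (c : ℝ) (a b x : Eu n) :
    Bop M h (c • a) b x = c * Bop M h a b x := by
  simp only [Bop, inner_smul_right, map_smul, smul_eq_mul]; ring

lemma Bop_add_left (M : Hypersurface n) (h : Eu n → ℝ) (a a' b x : Eu n) :
    Bop M h (a + a') b x = Bop M h a b x + Bop M h a' b x := by
  simp only [Bop, inner_add_right, map_add]; ring

lemma local_B' (M : Hypersurface n) (x₀ : Eu n) (hx : x₀ ∈ M.carrier) (u : Eu n)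
    (ht : 0 < ⟪M.nu x₀, u⟫) : ∃ U : Set (Eu n), IsOpen U ∧ x₀ ∈ U ∧
    ∀ h : Eu n → ℝ, ContDiff ℝ 1 h → HasCompactSupport h → tsupport h ⊆ U →
      ∀ v, ∫ x, Bop M h u v x ∂surfMeasure M = 0 := by
  have hu0 : u ≠ 0 := by rintro rfl; simp at ht
  have hun : 0 < ‖u‖ := norm_pos_iff.2 hu0
  obtain ⟨U, h1, h2, h3⟩ := local_B M x₀ hx (‖u‖⁻¹ • u) (by
    rw [norm_smul, norm_inv, norm_norm, inv_mul_cancel₀ hun.ne']) (by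
    rw [inner_smul_right]; positivity)
  refine ⟨U, h1, h2, fun h hh hc hs v => ?_⟩
  have h4 := h3 h hh hc hs v
  have : ∀ x, Bop M h u v x = ‖u‖ * Bop M h (‖u‖⁻¹ • u) v x := by
    intro x
    rw [← Bop_smul_left, smul_smul, mul_inv_cancel₀ hun.ne', one_smul]
  simp_rw [this, integral_const_mul, h4, mul_zero]

lemma local_C (M : Hypersurface n) (x₀ : Eu n) (hx : x₀ ∈ M.carrier) (a : Eu n) :
    ∃ U : Set (Eu n), IsOpen U ∧ x₀ ∈ U ∧
    ∀ h : Eu n → ℝ, ContDiff ℝ 1 h → HasCompactSupport h → tsupport h ⊆ U →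
      ∀ K : Set (Eu n), IsCompact K → K ⊆ M.carrier → (∀ x ∈ M.carrier, x ∉ K → h x = 0) →
      ∀ v, ∫ x, Bop M h a v x ∂surfMeasure M = 0 := by
  have hvv : ⟪M.nu x₀, M.nu x₀⟫ = 1 := by
    rw [real_inner_self_eq_norm_sq, M.unit_nu x₀ hx]; norm_num
  obtain ⟨s, hs0, hs⟩ : ∃ s : ℝ, s ≠ 0 ∧ 0 < ⟪M.nu x₀, M.nu x₀ + s • a⟫ := by
    by_cases h : 0 ≤ ⟪M.nu x₀, a⟫
    · refine ⟨1, one_ne_zero, ?_⟩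
      rw [inner_add_right, inner_smul_right, hvv]; linarith
    · refine ⟨-1, by norm_num, ?_⟩
      rw [inner_add_right, inner_smul_right, hvv]; linarith
  obtain ⟨U, h1, h2, h3⟩ := local_B' M x₀ hx (M.nu x₀) (by rw [hvv]; norm_num)
  obtain ⟨V, g1, g2, g3⟩ := local_B' M x₀ hx _ hs
  refine ⟨U ∩ V, h1.inter g1, ⟨h2, g2⟩, ?_⟩
  intro h hh hc hsup K hK hKM h0 v
  have i1 := h3 h hh hc (hsup.trans Set.inter_subset_left) v
  have i2 := g3 h hh hc (hsup.trans Set.inter_subset_right) v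
  simp_rw [Bop_add_left] at i2
  rw [integral_add (Bop_integrable M K hK hKM h hh h0 _ _)
    (Bop_integrable M K hK hKM h hh h0 _ _), i1, zero_add] at i2
  simp_rw [Bop_smul_left, integral_const_mul] at i2
  exact (mul_eq_zero.1 i2).resolve_left hs0

lemma global_D (M : Hypersurface n) (K : Set (Eu n)) (hK : IsCompact K) (hKM : K ⊆ M.carrier)
    (h : Eu n → ℝ) (hh : ContDiff ℝ 1 h) (h0 : ∀ x ∈ M.carrier, x ∉ K → h x = 0) (a b : Eu n) :
    ∫ x, Bop M h a b x ∂surfMeasure M = 0 := by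
  have H : ∀ x : Eu n, ∃ U : Set (Eu n), IsOpen U ∧ (x ∈ K → x ∈ U) ∧
    ∀ h : Eu n → ℝ, ContDiff ℝ 1 h → HasCompactSupport h → tsupport h ⊆ U →
      (∀ x ∈ M.carrier, x ∉ K → h x = 0) → ∫ x, Bop M h a b x ∂surfMeasure M = 0 := by
    intro x
    by_cases hx : x ∈ K
    · obtain ⟨U, h1, h2, h3⟩ := local_C M x (hKM hx) a
      exact ⟨U, h1, fun _ => h2, fun h hh hc hs h0 => h3 h hh hc hs K hK hKM h0 b⟩
    · refine ⟨∅, isOpen_empty, fun h => (hx h).elim, ?_⟩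
      intro h hh hc hs _
      have : h = 0 := by
        rw [← tsupport_eq_empty_iff]; exact Set.subset_empty_iff.1 hs
      simp [Bop, this]
  choose U hUo hxU hU using H
  obtain ⟨t, htK, hcov⟩ := hK.elim_nhds_subcover (fun x => U x ∩ Metric.ball x 1)
    (fun x hx => Filter.inter_mem ((hUo x).mem_nhds (hxU x hx)) (Metric.ball_mem_nhds x one_pos))
  obtain ⟨χ, hχ⟩ := SmoothPartitionOfUnity.exists_isSubordinate (modelWithCornersSelf ℝ (Eu n))
    hK.isClosed (fun i : t => U i ∩ Metric.ball (i : Eu n) 1)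
    (fun i => (hUo i).inter Metric.isOpen_ball) (by
      intro x hx
      have := hcov hx
      simp only [Set.mem_iUnion] at this ⊢
      obtain ⟨i, hi, hi2⟩ := this
      exact ⟨⟨i, hi⟩, hi2⟩)
  have hχc : ∀ i, ContDiff ℝ 1 (χ i) := fun i => (χ i).contMDiff.contDiff.of_le (by simp)
  have hsum : ∀ x ∈ M.carrier, h x - ∑ i, χ i x * h x = 0 := by
    intro x hx
    by_cases hxK : x ∈ K
    · have := χ.sum_eq_one hxK
      rw [finsum_eq_sum_of_fintype] at this
      rw [← Finset.sum_mul, this]; ring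
    · rw [h0 x hx hxK]; simp
  have hci : ∀ i, ContDiff ℝ 1 (fun x => χ i x * h x) := fun i => (hχc i).mul hh
  have hpt : ∀ x ∈ M.carrier, Bop M h a b x = ∑ i, Bop M (fun x => χ i x * h x) a b x := by
    intro x hx
    have h1 := Bop_zero M (fun x => h x - ∑ i, χ i x * h x)
      (hh.sub (ContDiff.sum fun i _ => hci i)) x hx Set.univ Filter.univ_mem
      (fun y hy => hsum y hy.1) a b
    have h2 : fderiv ℝ (fun x => h x - ∑ i, χ i x * h x) x =
        fderiv ℝ h x - ∑ i, fderiv ℝ (fun x => χ i x * h x) x := by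
      apply HasFDerivAt.fderiv
      exact (hh.differentiable (by simp) x).hasFDerivAt.sub
        (HasFDerivAt.fun_sum fun i _ => ((hci i).differentiable (by simp) x).hasFDerivAt)
    rw [Bop, h2] at h1
    simp only [sub_apply, sum_apply] at h1
    simp only [Bop, Finset.sum_sub_distrib, ← Finset.mul_sum]
    linarith
  have h0i : ∀ i, ∀ x ∈ M.carrier, x ∉ K → χ i x * h x = 0 := by
    intro i x hx hxK; rw [h0 x hx hxK, mul_zero]
  rw [integral_congr_ae (ae_surf M hpt), integral_finsetSum _
    (fun i _ => Bop_integrable M K hK hKM _ (hci i) (h0i i) a b)]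
  apply Finset.sum_eq_zero
  intro i _
  have hts : tsupport (fun x => χ i x * h x) ⊆ U i ∩ Metric.ball (i : Eu n) 1 :=
    (tsupport_mul_subset_left).trans (hχ i)
  apply hU i _ (hci i) _ (hts.trans Set.inter_subset_left) (h0i i)
  apply HasCompactSupport.of_support_subset_isCompact (isCompact_closedBall (i : Eu n) 1)
  exact (subset_tsupport _).trans (hts.trans (Set.inter_subset_right.trans Metric.ball_subset_closedBall))

lemma inner_single' (w : Eu n) (i : Fin (n + 1)) : ⟪w, EuclideanSpace.single i (1 : ℝ)⟫ = w i := by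
  simp [EuclideanSpace.inner_single_right]

lemma nu_sq (M : Hypersurface n) (x : Eu n) (hx : x ∈ M.carrier) :
    ∑ j, M.nu x j * M.nu x j = 1 := by
  have h := M.unit_nu x hx
  have h2 := EuclideanSpace.real_norm_sq_eq (M.nu x)
  rw [h] at h2
  simp_rw [← pow_two]
  rw [← h2]; norm_num

lemma nu_coord (M : Hypersurface n) (j : Fin (n + 1)) : ContDiff ℝ 1 (fun y => M.nu y j) :=
  (contDiff_euclidean.1 M.smooth_nu j).of_le (by simp)

lemma tdiv_eq (M : Hypersurface n) (hmin : ∀ x ∈ M.carrier, meanCurv M x = 0) (Z : Eu n → Eu n)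
    (hZ : ContDiff ℝ 1 Z) (x : Eu n) (hx : x ∈ M.carrier) :
    tdiv M.nu Z x = ∑ i, ∑ j, Bop M (fun y => M.nu y j * Z y i) (EuclideanSpace.single j 1)
      (EuclideanSpace.single i 1) x := by
  have hZc : ∀ i, ContDiff ℝ 1 (fun y => Z y i) := fun i => contDiff_euclidean.1 hZ i
  have hN := fun j => (nu_coord M j).differentiable (by simp) x
  have hD := fun i => (hZc i).differentiable (by simp) x
  have hns := nu_sq M x hx
  obtain ⟨c, hc⟩ := tang M (fun y => ∑ j, M.nu y j * M.nu y j - 1)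
    ((ContDiff.sum fun j _ => (nu_coord M j).mul (nu_coord M j)).sub contDiff_const) x hx Set.univ
    Filter.univ_mem (fun y hy => by rw [nu_sq M y hy.1]; ring)
  have hf : fderiv ℝ (fun y => ∑ j, M.nu y j * M.nu y j - 1) x =
      ∑ j, (M.nu x j • fderiv ℝ (fun y => M.nu y j) x + M.nu x j • fderiv ℝ (fun y => M.nu y j) x) := by
    apply HasFDerivAt.fderiv
    exact (HasFDerivAt.fun_sum fun j _ => (hN j).hasFDerivAt.mul (hN j).hasFDerivAt).sub_const 1
  have hc' : ∀ i, ∑ j, M.nu x j * fderiv ℝ (fun y => M.nu y j) x (EuclideanSpace.single i 1)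
      = c / 2 * M.nu x i := by
    intro i
    have := hc (EuclideanSpace.single i 1)
    rw [hf, inner_single'] at this
    simp only [sum_apply, add_apply, smul_apply, smul_eq_mul, Finset.sum_add_distrib] at this
    linarith
  have hH := hmin x hx
  simp only [meanCurv, tdiv, tderiv] at hH ⊢
  have hfm : ∀ i j, fderiv ℝ (fun y => M.nu y j * Z y i) x =
      M.nu x j • fderiv ℝ (fun y => Z y i) x + Z x i • fderiv ℝ (fun y => M.nu y j) x := by
    intro i j
    exact ((hN j).hasFDerivAt.mul (hD i).hasFDerivAt).fderiv
  simp only [Bop, hfm, inner_single', add_apply, smul_apply, smul_eq_mul]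
  generalize hNd : (fun j k => fderiv ℝ (fun y => M.nu y j) x (EuclideanSpace.single k 1)) = N at *
  have hNd' : ∀ j k, fderiv ℝ (fun y => M.nu y j) x (EuclideanSpace.single k 1) = N j k :=
    fun j k => by rw [← hNd]
  simp only [hNd'] at *
  generalize hDd : (fun i k => fderiv ℝ (fun y => Z y i) x (EuclideanSpace.single k 1)) = D at *
  have hDd' : ∀ i k, fderiv ℝ (fun y => Z y i) x (EuclideanSpace.single k 1) = D i k :=
    fun j k => by rw [← hDd]
  simp only [hDd'] at *
  generalize M.nu x = ν at *
  have hdiv : ∑ i, N i i = c / 2 := by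
    rw [Finset.sum_sub_distrib, sub_eq_zero] at hH
    rw [hH]
    calc ∑ i, ν i * ∑ j, N i j * ν j = ∑ i, ∑ j, ν j * (ν i * N i j) := by
          refine Finset.sum_congr rfl fun i _ => ?_
          rw [Finset.mul_sum]
          exact Finset.sum_congr rfl fun j _ => by ring
      _ = ∑ j, ν j * ∑ i, ν i * N i j := by
          rw [Finset.sum_comm]
          exact Finset.sum_congr rfl fun j _ => by rw [Finset.mul_sum]
      _ = ∑ j, c / 2 * (ν j * ν j) := by
          refine Finset.sum_congr rfl fun j _ => ?_
          rw [hc']; ring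
      _ = c / 2 := by rw [← Finset.mul_sum, hns, mul_one]
  refine Finset.sum_congr rfl fun i _ => ?_
  calc D i i - ν i * ∑ j, D i j * ν j
      = (∑ j, ν j * ν j) * D i i + Z x i * (∑ j, ν j * N j i) - ν i * (∑ j, D i j * ν j)
        - ν i * Z x i * ∑ j, N j j := by
        rw [hns, hc', hdiv]; ring
    _ = _ := by
        rw [Finset.sum_mul, Finset.mul_sum, Finset.mul_sum, Finset.mul_sum,
          ← Finset.sum_add_distrib, ← Finset.sum_sub_distrib, ← Finset.sum_sub_distrib]
        exact Finset.sum_congr rfl fun j _ => by ring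

lemma div_thm (M : Hypersurface n) (hmin : ∀ x ∈ M.carrier, meanCurv M x = 0)
    (K : Set (Eu n)) (hK : IsCompact K) (hKM : K ⊆ M.carrier) (Z : Eu n → Eu n)
    (hZ : ContDiff ℝ 1 Z) (h0 : ∀ x ∈ M.carrier, x ∉ K → Z x = 0) :
    Integrable (tdiv M.nu Z) (surfMeasure M) ∧ ∫ x, tdiv M.nu Z x ∂surfMeasure M = 0 := by
  have hZc : ∀ i, ContDiff ℝ 1 (fun y => Z y i) := fun i => contDiff_euclidean.1 hZ i
  have hc : ∀ i j, ContDiff ℝ 1 (fun y => M.nu y j * Z y i) := fun i j => (nu_coord M j).mul (hZc i)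
  have h0' : ∀ i j, ∀ x ∈ M.carrier, x ∉ K → M.nu x j * Z x i = 0 := by
    intro i j x hx hxK; rw [h0 x hx hxK]; simp
  have hi := fun i j => Bop_integrable M K hK hKM _ (hc i j) (h0' i j) (EuclideanSpace.single j 1)
      (EuclideanSpace.single i 1)
  have hae := ae_surf M (tdiv_eq M hmin Z hZ)
  constructor
  · refine Integrable.congr ?_ (Filter.EventuallyEq.symm hae)
    exact integrable_finsetSum _ fun i _ => integrable_finsetSum _ fun j _ => hi i j
  · rw [integral_congr_ae hae, integral_finsetSum _ fun i _ =>
      integrable_finsetSum _ fun j _ => hi i j]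
    apply Finset.sum_eq_zero
    intro i _
    rw [integral_finsetSum _ fun j _ => hi i j]
    exact Finset.sum_eq_zero fun j _ => global_D M K hK hKM _ (hc i j) (h0' i j) _ _

lemma young_aux (p b G : ℝ) (hp : 1 ≤ p) (hb : 0 ≤ b) (hG : 0 ≤ G) :
    p * (b ^ (p - 1) * G) ≤ (p - 1) * b ^ p + G ^ p := by
  have hp0 : 0 < p := by linarith
  have h := Real.geom_mean_le_arith_mean2_weighted (w₁ := (p - 1) / p) (w₂ := 1 / p)
    (p₁ := b ^ p) (p₂ := G ^ p) (div_nonneg (by linarith) hp0.le) (by positivity) (by positivity)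
    (by positivity) (by field_simp; ring)
  rw [← Real.rpow_mul hb, ← Real.rpow_mul hG, mul_div_cancel₀ _ hp0.ne', mul_one_div_cancel hp0.ne',
    Real.rpow_one] at h
  calc p * (b ^ (p - 1) * G) ≤ p * ((p - 1) / p * b ^ p + 1 / p * G ^ p) := by gcongr
    _ = _ := by field_simp

lemma tgrad_inner (M : Hypersurface n) (ψ : Eu n → ℝ) (x y : Eu n) :
    ⟪tgrad M.nu ψ x, y⟫ = fderiv ℝ ψ x (y - ⟪M.nu x, y⟫ • M.nu x) := by
  rw [tgrad, inner_sub_left, inner_smul_left, inner_gradient_left, inner_gradient_left, map_sub,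
    map_smul]
  simp; ring

lemma clm_sum (L : Eu n →L[ℝ] ℝ) (y : Eu n) : ∑ i, y i * L (EuclideanSpace.single i 1) = L y := by
  have h : y = ∑ i, y i • EuclideanSpace.single i (1 : ℝ) := by
    ext j
    simp [Finset.sum_apply, Pi.single_apply]
  conv_rhs => rw [h]
  simp

lemma tdiv_smul_id (M : Hypersurface n) (θ : Eu n → ℝ) (x : Eu n) (hx : x ∈ M.carrier)
    (L : Eu n →L[ℝ] ℝ) (hL : HasFDerivAt θ L x) :
    tdiv M.nu (fun y => θ y • y) x = n * θ x + L (x - ⟪M.nu x, x⟫ • M.nu x) := by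
  have hns := nu_sq M x hx
  have hf : ∀ i : Fin (n + 1), fderiv ℝ (fun y : Eu n => (θ y • y) i) x =
      θ x • (EuclideanSpace.proj i : Eu n →L[ℝ] ℝ) + x i • L := by
    intro i
    exact (hL.mul (EuclideanSpace.proj i : Eu n →L[ℝ] ℝ).hasFDerivAt).fderiv
  have hin : ⟪M.nu x, x⟫ = ∑ i, M.nu x i * x i := by
    simp [PiLp.inner_apply, mul_comm]
  simp only [tdiv, tderiv, hf, add_apply, smul_apply, smul_eq_mul, PiLp.proj_apply]
  have h1 : ∀ i, ∑ j, (θ x * (EuclideanSpace.single j (1 : ℝ) : Eu n) i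
      + x i * L (EuclideanSpace.single j 1)) * M.nu x j = θ x * M.nu x i + x i * L (M.nu x) := by
    intro i
    rw [← clm_sum L (M.nu x), Finset.mul_sum]
    simp_rw [add_mul]
    rw [Finset.sum_add_distrib]
    congr 1
    · simp
    · exact Finset.sum_congr rfl fun j _ => by ring
  simp_rw [h1]
  rw [Finset.sum_sub_distrib, Finset.sum_add_distrib, clm_sum L x]
  have h2 : ∑ i, M.nu x i * (θ x * M.nu x i + x i * L (M.nu x)) = θ x + ⟪M.nu x, x⟫ * L (M.nu x) := by
    rw [hin, Finset.sum_mul]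
    simp_rw [mul_add]
    rw [Finset.sum_add_distrib]
    congr 1
    · calc _ = ∑ i, θ x * (M.nu x i * M.nu x i) := Finset.sum_congr rfl fun j _ => by ring
        _ = θ x := by rw [← Finset.mul_sum, hns, mul_one]
    · exact Finset.sum_congr rfl fun j _ => by ring
  rw [h2, map_sub, map_smul]
  simp
  ring

/-- The weight. -/
def theta (p δ : ℝ) (ψ : Eu n → ℝ) (x : Eu n) : ℝ := ψ x ^ p * (‖x‖ ^ 2 + δ ^ 2) ^ (-p / 2)

lemma theta_contDiff (p δ : ℝ) (hp : 1 ≤ p) (hδ : 0 < δ) (ψ : Eu n → ℝ) (hψ : ContDiff ℝ 1 ψ) :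
    ContDiff ℝ 1 (theta p δ ψ) := by
  apply ContDiff.mul
  · exact hψ.rpow_const_of_le (m := 1) (by simpa using hp)
  · apply ContDiff.rpow_const_of_ne
    · exact (contDiff_norm_sq ℝ).add contDiff_const
    · intro x; positivity

lemma pointwise (M : Hypersurface n) (x : Eu n) (hx : x ∈ M.carrier) (p δ : ℝ) (hp : 1 ≤ p)
    (hpn : p < n) (hδ : 0 < δ) (ψ : Eu n → ℝ) (hψ : ContDiff ℝ 1 ψ) (hψ0 : ∀ x, 0 ≤ ψ x) :
    (((n : ℝ) - p) / p) ^ p * theta p δ ψ x - ‖tgrad M.nu ψ x‖ ^ p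
      ≤ (((n : ℝ) - p) / p) ^ (p - 1) * tdiv M.nu (fun y => theta p δ ψ y • y) x := by
  have hp0 : 0 < p := by linarith
  set a : ℝ := ((n : ℝ) - p) / p with ha
  have ha0 : 0 < a := div_pos (by linarith) hp0
  have hna : (n : ℝ) - p = p * a := by rw [ha]; field_simp
  set R2 : ℝ := ‖x‖ ^ 2 + δ ^ 2 with hR2
  have hR20 : 0 < R2 := by positivity
  set r := √R2 with hr
  have hr0 : 0 < r := Real.sqrt_pos.2 hR20
  have hrr : r ^ 2 = R2 := Real.sq_sqrt hR20.le
  have hd1 := ((hψ.differentiable (by simp) x).hasFDerivAt).rpow_const (p := p) (Or.inr hp)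
  have hd2 : HasFDerivAt (fun y : Eu n => (‖y‖ ^ 2 + δ ^ 2) ^ (-p / 2))
      ((-p / 2 * R2 ^ (-p / 2 - 1)) • (2 • innerSL ℝ x)) x := by
    exact ((hasStrictFDerivAt_norm_sq x).hasFDerivAt.add_const (δ ^ 2)).rpow_const
      (Or.inl hR20.ne')
  have hd := hd1.mul hd2
  rw [tdiv_smul_id M (theta p δ ψ) x hx _ hd]
  set G := ‖tgrad M.nu ψ x‖ with hG
  set xT := x - ⟪M.nu x, x⟫ • M.nu x with hxT
  have hx1 : ⟪x, xT⟫ ≤ R2 := by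
    rw [hxT, inner_sub_right, inner_smul_right, real_inner_self_eq_norm_sq, real_inner_comm]
    nlinarith [sq_nonneg ⟪M.nu x, x⟫]
  have hx2 : -(G * r) ≤ fderiv ℝ ψ x xT := by
    rw [← tgrad_inner]
    have h1 := (abs_le.1 (abs_real_inner_le_norm (tgrad M.nu ψ x) x)).1
    have h2 : ‖x‖ ≤ r := Real.le_sqrt_of_sq_le (by rw [hR2]; nlinarith)
    have : G * ‖x‖ ≤ G * r := by gcongr
    linarith
  simp only [add_apply, smul_apply, smul_eq_mul, innerSL_apply_apply, nsmul_eq_mul]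
  have e1 : R2 ^ (-p / 2) = r ^ (-p) := by
    rw [← hrr, ← Real.rpow_natCast, ← Real.rpow_mul hr0.le]; congr 1; push_cast; ring
  have e2 : R2 ^ (-p / 2 - 1) = r ^ (-p) / R2 := by
    rw [Real.rpow_sub_one hR20.ne', e1]
  have hθ : theta p δ ψ x = ψ x ^ p * r ^ (-p) := by rw [theta, ← hR2, e1]
  rw [hθ, ← hR2, e1, e2]
  set s := ψ x with hs
  have hs0 : 0 ≤ s := hψ0 x
  have eA : s ^ p * r ^ (-p) = (s / r) ^ p := by
    rw [Real.div_rpow hs0 hr0.le, Real.rpow_neg hr0.le]; rfl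
  have eB : s ^ (p - 1) * r ^ (-p) * r = (s / r) ^ (p - 1) := by
    rw [Real.div_rpow hs0 hr0.le, Real.rpow_neg hr0.le, Real.rpow_sub_one hr0.ne']
    field_simp
  have hA0 : 0 ≤ s / r := by positivity
  have low : p * a * (s / r) ^ p - p * ((s / r) ^ (p - 1) * G) ≤
      n * (s ^ p * r ^ (-p)) + (s ^ p * ((-p / 2 * (r ^ (-p) / R2)) * ((2 : ℕ) * ⟪x, xT⟫)) +
        r ^ (-p) * (p * s ^ (p - 1) * fderiv ℝ ψ x xT)) := by
    have t1 : s ^ p * ((-p / 2 * (r ^ (-p) / R2)) * ((2 : ℕ) * ⟪x, xT⟫)) ≥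
        - p * (s ^ p * r ^ (-p)) := by
      have : ⟪x, xT⟫ / R2 ≤ 1 := (div_le_one hR20).2 hx1
      have h2 : s ^ p * ((-p / 2 * (r ^ (-p) / R2)) * ((2 : ℕ) * ⟪x, xT⟫)) =
          - (p * (s ^ p * r ^ (-p)) * (⟪x, xT⟫ / R2)) := by push_cast; field_simp
      rw [h2]
      have h3 : p * (s ^ p * r ^ (-p)) * (⟪x, xT⟫ / R2) ≤ p * (s ^ p * r ^ (-p)) * 1 := by gcongr
      linarith
    have t2 : r ^ (-p) * (p * s ^ (p - 1) * fderiv ℝ ψ x xT) ≥ - (p * ((s / r) ^ (p - 1) * G)) := by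
      rw [← eB]
      have h3 : r ^ (-p) * (p * s ^ (p - 1)) * (-(G * r)) ≤
        r ^ (-p) * (p * s ^ (p - 1)) * fderiv ℝ ψ x xT := by gcongr
      calc _ = r ^ (-p) * (p * s ^ (p - 1)) * (-(G * r)) := by ring
        _ ≤ _ := h3
        _ = _ := by ring
    have t3 : p * a * (s / r) ^ p = n * (s ^ p * r ^ (-p)) - p * (s ^ p * r ^ (-p)) := by
      rw [← hna, eA]; ring
    linarith
  have hy := young_aux p (a * (s / r)) G hp (by positivity) (norm_nonneg _)
  have hap : a ^ p = a ^ (p - 1) * a := by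
    rw [Real.rpow_sub_one ha0.ne']; field_simp
  have hmul := mul_le_mul_of_nonneg_left low (by positivity : 0 ≤ a ^ (p - 1))
  rw [Real.mul_rpow ha0.le hA0, Real.mul_rpow ha0.le hA0] at hy
  refine le_trans ?_ hmul
  rw [eA]
  have : a ^ (p - 1) * (p * a * (s / r) ^ p - p * ((s / r) ^ (p - 1) * G)) =
    p * (a ^ p * (s / r) ^ p) - p * (a ^ (p - 1) * (s / r) ^ (p - 1) * G) := by rw [hap]; ring
  rw [this]
  linarith

lemma tgrad_zero (M : Hypersurface n) (h : Eu n → ℝ) (hh : ContDiff ℝ 1 h) (x : Eu n)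
    (hx : x ∈ M.carrier) (V : Set (Eu n)) (hV : V ∈ nhds x) (h0 : ∀ y ∈ M.carrier ∩ V, h y = 0) :
    tgrad M.nu h x = 0 := by
  obtain ⟨c, hc⟩ := tang M h hh x hx V hV h0
  apply ext_inner_right ℝ
  intro v
  have hvv : ⟪M.nu x, M.nu x⟫ = 1 := by
    rw [real_inner_self_eq_norm_sq, M.unit_nu x hx]; norm_num
  rw [tgrad_inner, hc, inner_sub_right, inner_smul_right, hvv]
  simp

lemma tgrad_cont (M : Hypersurface n) (h : Eu n → ℝ) (hh : ContDiff ℝ 1 h) :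
    Continuous (tgrad M.nu h) := by
  have h1 : Continuous (gradient h) :=
    (InnerProductSpace.toDual ℝ (Eu n)).symm.continuous.comp (hh.continuous_fderiv (by simp))
  have h2 := M.smooth_nu.continuous
  unfold tgrad
  fun_prop

/-- Smooth regularization of the absolute value. -/
def reg (δ : ℝ) (φ : Eu n → ℝ) (x : Eu n) : ℝ := √(φ x ^ 2 + δ ^ 2) - δ

lemma reg_contDiff (δ : ℝ) (hδ : 0 < δ) (φ : Eu n → ℝ) (hφ : ContDiff ℝ 1 φ) :
    ContDiff ℝ 1 (reg δ φ) :=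
  (((hφ.pow 2).add contDiff_const).sqrt (fun x => by positivity)).sub contDiff_const

lemma reg_nonneg (δ : ℝ) (hδ : 0 < δ) (φ : Eu n → ℝ) (x : Eu n) : 0 ≤ reg δ φ x := by
  rw [reg, sub_nonneg]
  apply Real.le_sqrt_of_sq_le
  nlinarith [sq_nonneg (φ x)]

lemma reg_le (δ : ℝ) (hδ : 0 < δ) (φ : Eu n → ℝ) (x : Eu n) : reg δ φ x ≤ |φ x| := by
  rw [reg, sub_le_iff_le_add, Real.sqrt_le_left (by positivity)]
  nlinarith [abs_nonneg (φ x), sq_abs (φ x)]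

lemma reg_tgrad (M : Hypersurface n) (δ : ℝ) (hδ : 0 < δ) (φ : Eu n → ℝ) (hφ : ContDiff ℝ 1 φ)
    (x : Eu n) : ‖tgrad M.nu (reg δ φ) x‖ ≤ ‖tgrad M.nu φ x‖ := by
  have hpos : 0 < φ x ^ 2 + δ ^ 2 := by positivity
  have hd : HasFDerivAt (reg δ φ) ((φ x / √(φ x ^ 2 + δ ^ 2)) • fderiv ℝ φ x) x := by
    have h1 := (hφ.differentiable (by simp) x).hasFDerivAt
    have h2 := (((h1.pow 2).add_const (δ ^ 2)).sqrt hpos.ne').sub_const δ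
    refine HasFDerivAt.congr_fderiv (f := reg δ φ) h2 ?_
    rw [smul_smul]
    congr 1
    have := (Real.sqrt_pos.2 hpos).ne'
    simp
    field_simp
  have : tgrad M.nu (reg δ φ) x = (φ x / √(φ x ^ 2 + δ ^ 2)) • tgrad M.nu φ x := by
    apply ext_inner_right ℝ
    intro v
    rw [inner_smul_left, tgrad_inner, tgrad_inner, hd.fderiv]
    simp
  rw [this, norm_smul]
  apply mul_le_of_le_one_left (norm_nonneg _)
  rw [Real.norm_eq_abs, abs_div, abs_of_pos (Real.sqrt_pos.2 hpos), div_le_one (Real.sqrt_pos.2 hpos)]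
  apply Real.abs_le_sqrt
  nlinarith [sq_nonneg δ]

lemma rpow_aux (p : ℝ) (x : Eu n) : (‖x‖ ^ 2) ^ (-p / 2) = (‖x‖ ^ p)⁻¹ := by
  rw [← Real.rpow_natCast, ← Real.rpow_mul (norm_nonneg _), ← Real.rpow_neg (norm_nonneg _)]
  congr 1; push_cast; ring

lemma theta_bound (p δ : ℝ) (hp : 1 ≤ p) (hδ : 0 < δ) (φ : Eu n → ℝ) (x : Eu n) (hx : x ≠ 0) :
    ‖theta p δ (reg δ φ) x‖ ≤ |φ x| ^ p / ‖x‖ ^ p := by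
  have h0 := reg_nonneg δ hδ φ x
  have hxp : 0 < ‖x‖ := norm_pos_iff.2 hx
  rw [theta, Real.norm_of_nonneg (by positivity), div_eq_mul_inv (|φ x| ^ p), ← rpow_aux]
  apply mul_le_mul _ _ (by positivity) (by positivity)
  · exact Real.rpow_le_rpow h0 (reg_le δ hδ φ x) (by linarith)
  · apply Real.rpow_le_rpow_of_nonpos (by positivity) (by nlinarith [sq_nonneg δ]) (by linarith)

lemma theta_lim (p : ℝ) (hp : 1 ≤ p) (φ : Eu n → ℝ) (x : Eu n) (hx : x ≠ 0) :
    Filter.Tendsto (fun δ => theta p δ (reg δ φ) x) (nhds 0) (nhds (|φ x| ^ p / ‖x‖ ^ p)) := by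
  have hxp : 0 < ‖x‖ := norm_pos_iff.2 hx
  have hc : ContinuousAt (fun δ => theta p δ (reg δ φ) x) 0 := by
    unfold theta reg
    apply ContinuousAt.mul
    · apply ContinuousAt.rpow_const _ (Or.inr (by linarith))
      fun_prop
    · apply ContinuousAt.rpow_const _ (Or.inl (by positivity))
      fun_prop
  have h0 : theta p 0 (reg 0 φ) x = |φ x| ^ p / ‖x‖ ^ p := by
    rw [theta, reg, div_eq_mul_inv (|φ x| ^ p), ← rpow_aux]
    simp [Real.sqrt_sq_eq_abs]
  rw [← h0]
  exact hc

/-- Sharp Euclidean Hardy inequality on minimal hypersurfaces, `p ∈ [1,n)`. -/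
theorem hardy_minimal (M : Hypersurface n) (hmin : ∀ x ∈ M.carrier, meanCurv M x = 0)
    (p : ℝ) (hp : 1 ≤ p) (hpn : p < n) (φ : Eu n → ℝ) (hφ : C1cOn M.carrier φ) :
    (((n : ℝ) - p) / p) ^ p * ∫ x, |φ x| ^ p / ‖x‖ ^ p ∂surfMeasure M
      ≤ ∫ x, ‖tgrad M.nu φ x‖ ^ p ∂surfMeasure M := by
  obtain ⟨hφc, K, hK, hKM, hφ0⟩ := hφ
  have hp0 : 0 < p := by linarith
  have hG0 : ∀ x ∈ M.carrier, x ∉ K → tgrad M.nu φ x = 0 := fun x hx hxK =>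
    tgrad_zero M φ hφc x hx Kᶜ (hK.isClosed.isOpen_compl.mem_nhds hxK) fun y hy => hφ0 y hy.1 hy.2
  have hGi : Integrable (fun x => ‖tgrad M.nu φ x‖ ^ p) (surfMeasure M) := by
    apply integrable_surf M K hK hKM
    · exact (tgrad_cont M φ hφc).norm.rpow_const fun _ => Or.inr hp0.le
    · intro x hx hxK
      rw [hG0 x hx hxK, norm_zero, Real.zero_rpow hp0.ne']
  have step : ∀ δ : ℝ, 0 < δ → (((n : ℝ) - p) / p) ^ p * ∫ x, theta p δ (reg δ φ) x ∂surfMeasure M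
      ≤ ∫ x, ‖tgrad M.nu φ x‖ ^ p ∂surfMeasure M := by
    intro δ hδ
    have hψ := reg_contDiff δ hδ φ hφc
    have hψ0 : ∀ x ∈ M.carrier, x ∉ K → theta p δ (reg δ φ) x = 0 := by
      intro x hx hxK
      rw [theta, reg, hφ0 x hx hxK]
      simp [Real.sqrt_sq hδ.le, Real.zero_rpow hp0.ne']
    have hθc := theta_contDiff p δ hp hδ _ hψ
    obtain ⟨d1, d2⟩ := div_thm M hmin K hK hKM (fun y => theta p δ (reg δ φ) y • y)
      (hθc.smul contDiff_id) (fun x hx hxK => by rw [hψ0 x hx hxK, zero_smul])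
    have hθi := integrable_surf M K hK hKM _ hθc.continuous hψ0
    have hle : ∫ x, ((((n : ℝ) - p) / p) ^ p * theta p δ (reg δ φ) x - ‖tgrad M.nu φ x‖ ^ p)
        ∂surfMeasure M ≤ ∫ x, (((n : ℝ) - p) / p) ^ (p - 1) *
          tdiv M.nu (fun y => theta p δ (reg δ φ) y • y) x ∂surfMeasure M := by
      apply integral_mono_ae ((hθi.const_mul _).sub hGi) (d1.const_mul _)
      apply ae_surf M
      intro x hx
      have h1 := pointwise M x hx p δ hp hpn hδ (reg δ φ) hψ (reg_nonneg δ hδ φ)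
      have h2 : ‖tgrad M.nu (reg δ φ) x‖ ^ p ≤ ‖tgrad M.nu φ x‖ ^ p :=
        Real.rpow_le_rpow (norm_nonneg _) (reg_tgrad M δ hδ φ hφc x) hp0.le
      simp only [Pi.sub_apply]
      linarith
    rw [integral_const_mul, d2, mul_zero, integral_sub (hθi.const_mul _) hGi,
      integral_const_mul] at hle
    linarith
  by_cases hint : Integrable (fun x => |φ x| ^ p / ‖x‖ ^ p) (surfMeasure M)
  swap
  · rw [integral_undef hint, mul_zero]
    exact integral_nonneg fun x => by positivity
  have hn0 : (0 : ℝ) < n := by linarith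
  have hne : ∀ᵐ x ∂surfMeasure M, x ≠ 0 := by
    have := Measure.noAtoms_hausdorff (Eu n) hn0
    apply ae_restrict_of_ae
    rw [ae_iff]
    simp only [ne_eq, not_not, Set.setOf_eq_eq_singleton]
    exact measure_singleton 0
  have hlim : Filter.Tendsto (fun k : ℕ => ∫ x, theta p (1 / ((k : ℝ) + 1)) (reg (1 / ((k : ℝ) + 1)) φ) x
      ∂surfMeasure M) Filter.atTop (nhds (∫ x, |φ x| ^ p / ‖x‖ ^ p ∂surfMeasure M)) := by
    apply tendsto_integral_of_dominated_convergence (fun x => |φ x| ^ p / ‖x‖ ^ p)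
    · intro k
      have hk : (0 : ℝ) < 1 / ((k : ℝ) + 1) := by positivity
      exact (theta_contDiff p _ hp hk _ (reg_contDiff _ hk φ hφc)).continuous.aestronglyMeasurable
    · exact hint
    · intro k
      filter_upwards [hne] with x hx
      exact theta_bound p _ hp (by positivity) φ x hx
    · filter_upwards [hne] with x hx
      exact (theta_lim p hp φ x hx).comp tendsto_one_div_add_atTop_nhds_zero_nat
  exact le_of_tendsto (hlim.const_mul _) (Filter.Eventually.of_forall fun k => step _ (by positivity))
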